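/- For every h-normal Γ-linear connection of Cartan type, the nonmetrical deflection d-tensors Dbar^i = (y^i)_/1 (upper vertical i, lower temporal), D^i_j = (y^i)_|j (upper vertical i, lower spatial j) and d^i_j = (y^i)|_(j) (upper vertical i, lower vertical j) satisfy the following five identities for all indices i, j, k: (Dbar^i)_|k − (D^i_k)_/1 = y^r R^i_r1k − D^i_r T^r_1k − d^i_r Rv^r_1k; (D^i_j)_|k − (D^i_k)_|j = y^r R^i_rjk − d^i_r Rv^r_jk; (Dbar^i)|_(k) − (d^i_k)_/1 = y^r P^i_r1(k) − d^i_r Pv^r_1k; (D^i_j)|_(k) − (d^i_k)_|j = y^r P^i_rj(k) − D^i_r C^r_jk − d^i_r Pv^r_jk; (d^i_j)|_(k) − (d^i_k)|_(j) = y^r S^i_r(j)(k). -/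

import Mathlib

open Finset

noncomputable section

namespace Jet

/-- Smooth real-valued functions of `(t, x, y) ∈ ℝ × ℝⁿ × ℝⁿ`, the local coordinates
of the 1-jet space `J¹(ℝ, M)`. -/
abbrev Fn (n : ℕ) : Type := ℝ → (Fin n → ℝ) → (Fin n → ℝ) → ℝ

def Smooth {n : ℕ} (F : Fn n) : Prop :=
  ContDiff ℝ (⊤ : ℕ∞) (fun p : ℝ × (Fin n → ℝ) × (Fin n → ℝ) => F p.1 p.2.1 p.2.2)

/-- Partial derivative in the time variable `t`. -/
def pt {n : ℕ} (F : Fn n) : Fn n := fun t x y => deriv (fun s => F s x y) t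

/-- Partial derivative in the spatial variable `xⁱ`. -/
def px {n : ℕ} (i : Fin n) (F : Fn n) : Fn n :=
  fun t x y => deriv (fun s => F t (Function.update x i s) y) (x i)

/-- Partial derivative in the fibre variable `yⁱ`. -/
def py {n : ℕ} (i : Fin n) (F : Fn n) : Fn n :=
  fun t x y => deriv (fun s => F t x (Function.update y i s)) (y i)

/-- Kronecker delta, as a constant function on the jet space. -/
def kron {n : ℕ} (i j : Fin n) : Fn n := if i = j then 1 else 0

/-- The coordinate function `yⁱ`. -/
def yc {n : ℕ} (i : Fin n) : Fn n := fun _ _ y => y i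

/-- The Christoffel symbol `κ(t) = (1/(2h)) dh/dt` of a Riemannian metric `h` on `ℝ`,
as a function on the jet space. -/
def chr {n : ℕ} (h : ℝ → ℝ) : Fn n := fun t _ _ => deriv h t / (2 * h t)

/-- The metric `h(t)` as a function on the jet space. -/
def hfun {n : ℕ} (h : ℝ → ℝ) : Fn n := fun t _ _ => h t

/-- The derivative `dh/dt` as a function on the jet space. -/
def hder {n : ℕ} (h : ℝ → ℝ) : Fn n := fun t _ _ => deriv h t

variable {n : ℕ}

/-- The adapted temporal derivative `δ/δt = ∂/∂t − Mʳ ∂/∂yʳ` determined by a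
nonlinear connection `(M, N)`. -/
def dt (M : Fin n → Fn n) (F : Fn n) : Fn n := pt F - ∑ r, M r * py r F

/-- The adapted spatial derivative `δ/δxᵏ = ∂/∂xᵏ − Nʳₖ ∂/∂yʳ`. -/
def dx (N : Fin n → Fin n → Fn n) (k : Fin n) (F : Fn n) : Fn n :=
  px k F - ∑ r, N r k * py r F

/-- An `h`-normal `Γ`-linear connection `(κ, Gᵏᵢ, Lᵏᵢⱼ, Cᵏᵢⱼ)`. -/
structure Conn (n : ℕ) where
  κ : Fn n
  G : Fin n → Fin n → Fn n
  L : Fin n → Fin n → Fin n → Fn n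
  C : Fin n → Fin n → Fin n → Fn n

/-! ### Torsion d-tensors -/

/-- `Tʳ₁ⱼ = −Gʳⱼ`. -/
def T1 (Γ : Conn n) (r j : Fin n) : Fn n := -Γ.G r j

/-- `Rvʳ₁ⱼ = (δ/δxʲ)Mʳ − (δ/δt)Nʳⱼ`. -/
def Rv1 (M : Fin n → Fn n) (N : Fin n → Fin n → Fn n) (r j : Fin n) : Fn n :=
  dx N j (M r) - dt M (N r j)

/-- `Tʳᵢⱼ = Lʳᵢⱼ − Lʳⱼᵢ`. -/
def Tsp (Γ : Conn n) (r i j : Fin n) : Fn n := Γ.L r i j - Γ.L r j i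

/-- `Rvʳᵢⱼ = (δ/δxʲ)Nʳᵢ − (δ/δxⁱ)Nʳⱼ`. -/
def Rvsp (M : Fin n → Fn n) (N : Fin n → Fin n → Fn n) (r i j : Fin n) : Fn n :=
  dx N j (N r i) - dx N i (N r j)

/-- `Pvʳ₁ⱼ = ∂Mʳ/∂yʲ − Gʳⱼ + δʳⱼ κ`. -/
def Pv1 (M : Fin n → Fn n) (Γ : Conn n) (r j : Fin n) : Fn n :=
  py j (M r) - Γ.G r j + kron r j * Γ.κ

/-- `Phʳᵢⱼ = Cʳᵢⱼ`. -/
def Phsp (Γ : Conn n) (r i j : Fin n) : Fn n := Γ.C r i j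

/-- `Pvʳᵢⱼ = ∂Nʳᵢ/∂yʲ − Lʳⱼᵢ`. -/
def Pvsp (N : Fin n → Fin n → Fn n) (Γ : Conn n) (r i j : Fin n) : Fn n :=
  py j (N r i) - Γ.L r j i

/-- `Sʳᵢⱼ = Cʳᵢⱼ − Cʳⱼᵢ`. -/
def Ssp (Γ : Conn n) (r i j : Fin n) : Fn n := Γ.C r i j - Γ.C r j i

/-! ### Generic covariant derivatives of d-tensors -/

/-- Index types of the (valued) indices of a d-tensor: upper/lower spatial,
upper/lower vertical.  (Temporal indices carry no value; they are accounted for by the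
temporal weight `p` = number of upper temporal indices minus number of lower temporal
indices.) -/
inductive IdxType | uS | lS | uV | lV

/-- A d-tensor component family with `m` valued indices. -/
abbrev Tensor (n m : ℕ) := (Fin m → Fin n) → Fn n

/-- The `ℝ`-horizontal covariant derivative `D_{/1}` of a d-tensor `D` with valued index
signature `σ` and temporal weight `p`. -/
def covT {m : ℕ} (M : Fin n → Fn n) (Γ : Conn n) (p : ℤ) (σ : Fin m → IdxType)
    (D : Tensor n m) : Tensor n m := fun a =>
  dt M (D a) + p • (Γ.κ * D a)
    + ∑ q : Fin m,
      (match σ q with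
      | .uS => ∑ r, D (Function.update a q r) * Γ.G (a q) r
      | .lS => -∑ r, D (Function.update a q r) * Γ.G r (a q)
      | .uV => ∑ r, D (Function.update a q r) * (Γ.G (a q) r - kron (a q) r * Γ.κ)
      | .lV => -∑ r, D (Function.update a q r) * (Γ.G r (a q) - kron r (a q) * Γ.κ) : Fn n)

/-- The `M`-horizontal covariant derivative `D_{|k}`. -/
def covX {m : ℕ} (N : Fin n → Fin n → Fn n) (Γ : Conn n) (σ : Fin m → IdxType)
    (k : Fin n) (D : Tensor n m) : Tensor n m := fun a =>
  dx N k (D a)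
    + ∑ q : Fin m,
      (match σ q with
      | .uS => ∑ r, D (Function.update a q r) * Γ.L (a q) r k
      | .uV => ∑ r, D (Function.update a q r) * Γ.L (a q) r k
      | .lS => -∑ r, D (Function.update a q r) * Γ.L r (a q) k
      | .lV => -∑ r, D (Function.update a q r) * Γ.L r (a q) k : Fn n)

/-- The vertical covariant derivative `D|_{(k)}`. -/
def covY {m : ℕ} (Γ : Conn n) (σ : Fin m → IdxType)
    (k : Fin n) (D : Tensor n m) : Tensor n m := fun a =>
  py k (D a)
    + ∑ q : Fin m,
      (match σ q with
      | .uS => ∑ r, D (Function.update a q r) * Γ.C (a q) r k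
      | .uV => ∑ r, D (Function.update a q r) * Γ.C (a q) r k
      | .lS => -∑ r, D (Function.update a q r) * Γ.C r (a q) k
      | .lV => -∑ r, D (Function.update a q r) * Γ.C r (a q) k : Fn n)

/-- The coefficients `Cᵏᵢⱼ` viewed as a d-tensor with signature
(upper spatial, lower spatial, lower vertical). -/
def CT (Γ : Conn n) : Tensor n 3 := fun a => Γ.C (a 0) (a 1) (a 2)

/-- The signature of `Cᵏᵢⱼ`. -/
def sigC : Fin 3 → IdxType := ![IdxType.uS, IdxType.lS, IdxType.lV]

/-! ### Curvature d-tensors -/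

/-- `Rˡᵢ₁ₖ`. -/
def Rc1 (M : Fin n → Fn n) (N : Fin n → Fin n → Fn n) (Γ : Conn n) (l i k : Fin n) : Fn n :=
  dx N k (Γ.G l i) - dt M (Γ.L l i k) + ∑ r, Γ.G r i * Γ.L l r k
    - ∑ r, Γ.L r i k * Γ.G l r + ∑ r, Γ.C l i r * Rv1 M N r k

/-- `Rˡᵢⱼₖ`. -/
def Rc (M : Fin n → Fn n) (N : Fin n → Fin n → Fn n) (Γ : Conn n) (l i j k : Fin n) : Fn n :=
  dx N k (Γ.L l i j) - dx N j (Γ.L l i k) + ∑ r, Γ.L r i j * Γ.L l r k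
    - ∑ r, Γ.L r i k * Γ.L l r j + ∑ r, Γ.C l i r * Rvsp M N r j k

/-- `Pˡᵢ₁₍ₖ₎`. -/
def Pc1 (M : Fin n → Fn n) (N : Fin n → Fin n → Fn n) (Γ : Conn n) (l i k : Fin n) : Fn n :=
  py k (Γ.G l i) - covT M Γ 0 sigC (CT Γ) ![l, i, k] + ∑ r, Γ.C l i r * Pv1 M Γ r k

/-- `Pˡᵢⱼ₍ₖ₎`. -/
def Pc (M : Fin n → Fn n) (N : Fin n → Fin n → Fn n) (Γ : Conn n) (l i j k : Fin n) : Fn n :=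
  py k (Γ.L l i j) - covX N Γ sigC j (CT Γ) ![l, i, k] + ∑ r, Γ.C l i r * Pvsp N Γ r j k

/-- `Sˡᵢ₍ⱼ₎₍ₖ₎`. -/
def Sc (Γ : Conn n) (l i j k : Fin n) : Fn n :=
  py k (Γ.C l i j) - py j (Γ.C l i k)
    + ∑ r, Γ.C r i j * Γ.C l r k - ∑ r, Γ.C r i k * Γ.C l r j

end Jet

namespace Jet

variable {n : ℕ}

/-- A family with one valued index, viewed as a d-tensor. -/
def famT (X : Fin n → Fn n) : Tensor n 1 := fun a => X (a 0)

def T1T (Γ : Conn n) : Tensor n 2 := fun a => T1 Γ (a 0) (a 1)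
def Rv1T (M : Fin n → Fn n) (N : Fin n → Fin n → Fn n) : Tensor n 2 :=
  fun a => Rv1 M N (a 0) (a 1)
def RvspT (M : Fin n → Fn n) (N : Fin n → Fin n → Fn n) : Tensor n 3 :=
  fun a => Rvsp M N (a 0) (a 1) (a 2)
def Pv1T (M : Fin n → Fn n) (Γ : Conn n) : Tensor n 2 := fun a => Pv1 M Γ (a 0) (a 1)
def PvspT (N : Fin n → Fin n → Fn n) (Γ : Conn n) : Tensor n 3 :=
  fun a => Pvsp N Γ (a 0) (a 1) (a 2)
def Rc1T (M : Fin n → Fn n) (N : Fin n → Fin n → Fn n) (Γ : Conn n) : Tensor n 3 :=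
  fun a => Rc1 M N Γ (a 0) (a 1) (a 2)
def RcT (M : Fin n → Fn n) (N : Fin n → Fin n → Fn n) (Γ : Conn n) : Tensor n 4 :=
  fun a => Rc M N Γ (a 0) (a 1) (a 2) (a 3)
def Pc1T (M : Fin n → Fn n) (N : Fin n → Fin n → Fn n) (Γ : Conn n) : Tensor n 3 :=
  fun a => Pc1 M N Γ (a 0) (a 1) (a 2)
def PcT (M : Fin n → Fn n) (N : Fin n → Fin n → Fn n) (Γ : Conn n) : Tensor n 4 :=
  fun a => Pc M N Γ (a 0) (a 1) (a 2) (a 3)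
def ScT (Γ : Conn n) : Tensor n 4 := fun a => Sc Γ (a 0) (a 1) (a 2) (a 3)

/-- valued-index signatures (temporal indices are tracked by the weight `p` only) -/
def sig0 : Fin 0 → IdxType := ![]
def siglS : Fin 1 → IdxType := ![IdxType.lS]
def siglV : Fin 1 → IdxType := ![IdxType.lV]
def sigU : Fin 1 → IdxType := ![IdxType.uS]
def sigV : Fin 1 → IdxType := ![IdxType.uV]
def sigUlS : Fin 2 → IdxType := ![IdxType.uS, IdxType.lS]
def sigUlV : Fin 2 → IdxType := ![IdxType.uS, IdxType.lV]
def sigVlS : Fin 2 → IdxType := ![IdxType.uV, IdxType.lS]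
def sigVlV : Fin 2 → IdxType := ![IdxType.uV, IdxType.lV]
def sigRvsp : Fin 3 → IdxType := ![IdxType.uV, IdxType.lS, IdxType.lS]
def sigPvsp : Fin 3 → IdxType := ![IdxType.uV, IdxType.lS, IdxType.lV]
def sigRc1 : Fin 3 → IdxType := ![IdxType.uS, IdxType.lS, IdxType.lS]
def sigRc : Fin 4 → IdxType := ![IdxType.uS, IdxType.lS, IdxType.lS, IdxType.lS]
def sigPc1 : Fin 3 → IdxType := ![IdxType.uS, IdxType.lS, IdxType.lV]
def sigPc : Fin 4 → IdxType := ![IdxType.uS, IdxType.lS, IdxType.lS, IdxType.lV]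
def sigSc : Fin 4 → IdxType := ![IdxType.uS, IdxType.lS, IdxType.lV, IdxType.lV]

end Jet

namespace Jet

variable {n : ℕ}

lemma Smooth.differentiable {F : Fn n} (hF : Smooth F) :
    Differentiable ℝ (fun p : ℝ × (Fin n → ℝ) × (Fin n → ℝ) => F p.1 p.2.1 p.2.2) :=
  ContDiff.differentiable hF (by simp)

lemma smooth_yc (i : Fin n) : Smooth (yc i) := by
  unfold Smooth yc
  fun_prop

lemma smooth_kron (i j : Fin n) : Smooth (kron i j) := by
  unfold kron
  split_ifs <;> exact contDiff_const

lemma smooth_chr {h : ℝ → ℝ} (hh : ContDiff ℝ (⊤ : ℕ∞) h) (hpos : ∀ t, 0 < h t) :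
    Smooth (chr h : Fn n) := by
  have hd : ContDiff ℝ (⊤ : ℕ∞) (deriv h) := ((contDiff_infty_iff_deriv (f := h)).1 hh).2
  have hq : ContDiff ℝ (⊤ : ℕ∞) (fun t => deriv h t / (2 * h t)) :=
    hd.div (contDiff_const.mul hh) fun t => (mul_pos two_pos (hpos t)).ne'
  exact hq.comp contDiff_fst

lemma Smooth.add {F H : Fn n} (hF : Smooth F) (hH : Smooth H) : Smooth (F + H) :=
  ContDiff.add hF hH

lemma Smooth.neg {F : Fn n} (hF : Smooth F) : Smooth (-F) :=
  ContDiff.neg hF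

lemma Smooth.mul {F H : Fn n} (hF : Smooth F) (hH : Smooth H) : Smooth (F * H) :=
  ContDiff.mul hF hH

lemma Smooth.sum {ι : Type*} (s : Finset ι) {F : ι → Fn n} (hF : ∀ r, Smooth (F r)) :
    Smooth (∑ r ∈ s, F r) := by
  unfold Smooth
  simp only [Finset.sum_apply]
  exact ContDiff.sum fun r _ => hF r

/-- An operator on functions on the jet space that is a derivation on smooth functions. -/
structure IsDerivation (E : Fn n → Fn n) : Prop where
  add : ∀ F H, Smooth F → Smooth H → E (F + H) = E F + E H
  mul : ∀ F H, Smooth F → Smooth H → E (F * H) = E F * H + F * E H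
  one : E 1 = 0

lemma isDerivation_of_deriv {E : Fn n → Fn n}
    (γ : ℝ → (Fin n → ℝ) → (Fin n → ℝ) → ℝ → ℝ × (Fin n → ℝ) × (Fin n → ℝ))
    (c : ℝ → (Fin n → ℝ) → (Fin n → ℝ) → ℝ)
    (hγ : ∀ t x y, Differentiable ℝ (γ t x y)) (hc : ∀ t x y, γ t x y (c t x y) = (t, x, y))
    (hE : ∀ F t x y, E F t x y = deriv (fun s => F (γ t x y s).1 (γ t x y s).2.1
      (γ t x y s).2.2) (c t x y)) : IsDerivation E := by
  have hd : ∀ F, Smooth F → ∀ t x y, DifferentiableAt ℝ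
      (fun s => F (γ t x y s).1 (γ t x y s).2.1 (γ t x y s).2.2) (c t x y) :=
    fun F hF t x y => (hF.differentiable.comp (hγ t x y)).differentiableAt
  refine ⟨fun F H hF hH => ?_, fun F H hF hH => ?_, ?_⟩
  · ext t x y
    simp only [Pi.add_apply, hE]
    exact deriv_fun_add (hd F hF t x y) (hd H hH t x y)
  · ext t x y
    simp only [Pi.add_apply, Pi.mul_apply, hE]
    rw [deriv_fun_mul (hd F hF t x y) (hd H hH t x y), hc]
  · ext t x y
    simp [hE]

lemma isDerivation_pt : IsDerivation (pt : Fn n → Fn n) :=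
  isDerivation_of_deriv (fun _ x y s => (s, x, y)) (fun t _ _ => t)
    (fun _ _ _ => by fun_prop) (fun _ _ _ => rfl) fun _ _ _ _ => rfl

lemma differentiable_update (x : Fin n → ℝ) (i : Fin n) :
    Differentiable ℝ (Function.update x i) :=
  fun s => (hasDerivAt_update x i s).differentiableAt

lemma isDerivation_px (i : Fin n) : IsDerivation (px i) :=
  isDerivation_of_deriv (fun t x y s => (t, Function.update x i s, y)) (fun _ x _ => x i)
    (fun t x y => (differentiable_const t).prodMk
      ((differentiable_update x i).prodMk (differentiable_const y)))
    (fun _ _ _ => by simp) fun _ _ _ _ => rfl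

lemma isDerivation_py (i : Fin n) : IsDerivation (py i) :=
  isDerivation_of_deriv (fun t x y s => (t, x, Function.update y i s)) (fun _ _ y => y i)
    (fun t x y => (differentiable_const t).prodMk
      ((differentiable_const x).prodMk (differentiable_update y i)))
    (fun _ _ _ => by simp) fun _ _ _ _ => rfl

namespace IsDerivation

variable {E : Fn n → Fn n}

lemma sub_sum_mul (hE : IsDerivation E) {P : Fin n → Fn n → Fn n}
    (hP : ∀ r, IsDerivation (P r)) (A : Fin n → Fn n) :
    IsDerivation (fun F => E F - ∑ r, A r * P r F) := by
  refine ⟨fun F H hF hH => ?_, fun F H hF hH => ?_, ?_⟩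
  · simp only [hE.add F H hF hH, fun r => (hP r).add F H hF hH, mul_add, sum_add_distrib]
    ring
  · simp only [hE.mul F H hF hH, fun r => (hP r).mul F H hF hH, mul_add, sum_add_distrib,
      sub_mul, mul_sub, sum_mul, mul_sum, mul_assoc, mul_left_comm (A _) F]
    ring
  · simp [hE.one, fun r => (hP r).one]

lemma zero (hE : IsDerivation E) : E 0 = 0 := by
  have h0 : Smooth (0 : Fn n) := contDiff_const
  simpa using hE.add 0 0 h0 h0

lemma neg (hE : IsDerivation E) {F : Fn n} (hF : Smooth F) : E (-F) = -E F := by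
  have := hE.add (-F) F hF.neg hF
  rw [neg_add_cancel, hE.zero] at this
  exact eq_neg_of_add_eq_zero_left this.symm

lemma kron (hE : IsDerivation E) (i j : Fin n) : E (kron i j) = 0 := by
  unfold Jet.kron
  split_ifs
  exacts [hE.one, hE.zero]

lemma sum (hE : IsDerivation E) {ι : Type*} (s : Finset ι) {F : ι → Fn n}
    (hF : ∀ r, Smooth (F r)) : E (∑ r ∈ s, F r) = ∑ r ∈ s, E (F r) := by
  classical
  induction s using Finset.induction_on with
  | empty => simpa using hE.zero
  | insert a s ha ih =>
    rw [sum_insert ha, sum_insert ha, hE.add _ _ (hF a) (Smooth.sum s hF), ih]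

/-- The value of a derivation on an affine expression in the fibre coordinates. -/
lemma add_sum_yc_mul (hE : IsDerivation E) {A : Fn n} {B : Fin n → Fn n}
    (hA : Smooth A) (hB : ∀ r, Smooth (B r)) :
    E (A + ∑ r, yc r * B r)
      = E A + ∑ r, E (yc r) * B r + ∑ r, yc r * E (B r) := by
  have hm : ∀ r, Smooth (yc r * B r) := fun r => (smooth_yc r).mul (hB r)
  rw [hE.add _ _ hA (Smooth.sum _ hm), hE.sum _ hm]
  simp only [fun r => hE.mul _ _ (smooth_yc r) (hB r), sum_add_distrib, add_assoc]

end IsDerivation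

lemma isDerivation_dt (M : Fin n → Fn n) : IsDerivation (dt M) :=
  isDerivation_pt.sub_sum_mul isDerivation_py M

lemma isDerivation_dx (N : Fin n → Fin n → Fn n) (k : Fin n) : IsDerivation (dx N k) :=
  (isDerivation_px k).sub_sum_mul isDerivation_py fun r => N r k

lemma sum_mul_kron (A : Fin n → Fn n) (i : Fin n) : ∑ r, A r * kron r i = A i := by
  simp [kron]

lemma sum_mul_kron' (A : Fin n → Fn n) (i : Fin n) : ∑ r, A r * kron i r = A i := by
  simp [kron]

lemma sum_kron_mul (A : Fin n → Fn n) (i : Fin n) : ∑ r, kron r i * A r = A i := by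
  simp [kron]

lemma sum_kron_mul' (A : Fin n → Fn n) (i : Fin n) : ∑ r, kron i r * A r = A i := by
  simp [kron]

lemma py_yc (k i : Fin n) : py k (yc i) = kron i k := by
  ext t x y
  by_cases hik : i = k
  · subst hik
    simp [py, yc, kron]
  · simp [py, yc, kron, hik]

lemma pt_yc (i : Fin n) : pt (yc i) = 0 := by
  ext t x y
  simp [pt, yc]

lemma px_yc (k i : Fin n) : px k (yc i) = 0 := by
  ext t x y
  simp [px, yc]

lemma dt_yc (M : Fin n → Fn n) (i : Fin n) : dt M (yc i) = -M i := by
  simp [dt, pt_yc, py_yc, sum_mul_kron']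

lemma dx_yc (N : Fin n → Fin n → Fn n) (k i : Fin n) : dx N k (yc i) = -N i k := by
  simp [dx, px_yc, py_yc, sum_mul_kron']

lemma py_chr (h : ℝ → ℝ) (k : Fin n) : py k (chr h) = 0 := by
  ext t x y
  simp [py, chr]

lemma dx_chr (h : ℝ → ℝ) (N : Fin n → Fin n → Fn n) (k : Fin n) : dx N k (chr h) = 0 := by
  have : px k (chr h) = 0 := by
    ext t x y
    simp [px, chr]
  simp [dx, this, py_chr]

lemma sum_sum_yc_mul (A : Fin n → Fin n → Fn n) (B : Fin n → Fn n) :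
    ∑ r, (∑ s, yc s * A s r) * B r = ∑ s, yc s * ∑ r, A s r * B r := by
  simp only [sum_mul, mul_sum, mul_assoc]
  exact sum_comm

/-! ### The deflection d-tensors in local coordinates -/

lemma covT_yc (M : Fin n → Fn n) (Γ : Conn n) :
    covT M Γ 0 sigV (famT yc)
      = fun a => (-M (a 0) + -(Γ.κ * yc (a 0))) + ∑ r, yc r * Γ.G (a 0) r := by
  funext a
  simp [covT, sigV, famT, dt_yc, mul_sub, sum_sub_distrib, ← mul_assoc, ← sum_mul,
    sum_mul_kron']
  ring

lemma covX_yc (N : Fin n → Fin n → Fn n) (Γ : Conn n) (k : Fin n) :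
    covX N Γ sigV k (famT yc) = fun a => -N (a 0) k + ∑ r, yc r * Γ.L (a 0) r k := by
  funext a
  simp [covX, sigV, famT, dx_yc]

lemma covY_yc (Γ : Conn n) (k : Fin n) :
    covY Γ sigV k (famT yc) = fun a => kron (a 0) k + ∑ r, yc r * Γ.C (a 0) r k := by
  funext a
  simp [covY, sigV, famT, py_yc]

lemma update_pair_zero {α : Type*} (i j r : α) :
    Function.update ![i, j] 0 r = ![r, j] := by
  ext q
  fin_cases q <;> simp

lemma update_pair_one {α : Type*} (i j r : α) :
    Function.update ![i, j] 1 r = ![i, r] := by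
  ext q
  fin_cases q <;> simp

lemma update_single {α : Type*} (i r : α) : Function.update ![i] 0 r = ![r] := by
  ext q
  fin_cases q
  simp

/-! ### Covariant derivatives of low-rank d-tensors -/

lemma covX_sigV (N : Fin n → Fin n → Fn n) (Γ : Conn n) (k i : Fin n) (D : Tensor n 1) :
    covX N Γ sigV k D ![i] = dx N k (D ![i]) + ∑ r, D ![r] * Γ.L i r k := by
  simp [covX, sigV, update_single]

lemma covY_sigV (Γ : Conn n) (k i : Fin n) (D : Tensor n 1) :
    covY Γ sigV k D ![i] = py k (D ![i]) + ∑ r, D ![r] * Γ.C i r k := by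
  simp [covY, sigV, update_single]

lemma covX_sigVlS (N : Fin n → Fin n → Fn n) (Γ : Conn n) (k i j : Fin n) (D : Tensor n 2) :
    covX N Γ sigVlS k D ![i, j]
      = dx N k (D ![i, j]) + ∑ r, D ![r, j] * Γ.L i r k - ∑ r, D ![i, r] * Γ.L r j k := by
  simp [covX, sigVlS, update_pair_zero, update_pair_one]
  ring

lemma covX_sigVlV (N : Fin n → Fin n → Fn n) (Γ : Conn n) (k i j : Fin n) (D : Tensor n 2) :
    covX N Γ sigVlV k D ![i, j]
      = dx N k (D ![i, j]) + ∑ r, D ![r, j] * Γ.L i r k - ∑ r, D ![i, r] * Γ.L r j k := by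
  simp [covX, sigVlV, update_pair_zero, update_pair_one]
  ring

lemma covY_sigVlS (Γ : Conn n) (k i j : Fin n) (D : Tensor n 2) :
    covY Γ sigVlS k D ![i, j]
      = py k (D ![i, j]) + ∑ r, D ![r, j] * Γ.C i r k - ∑ r, D ![i, r] * Γ.C r j k := by
  simp [covY, sigVlS, update_pair_zero, update_pair_one]
  ring

lemma covY_sigVlV (Γ : Conn n) (k i j : Fin n) (D : Tensor n 2) :
    covY Γ sigVlV k D ![i, j]
      = py k (D ![i, j]) + ∑ r, D ![r, j] * Γ.C i r k - ∑ r, D ![i, r] * Γ.C r j k := by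
  simp [covY, sigVlV, update_pair_zero, update_pair_one]
  ring

lemma covT_sigVlS (M : Fin n → Fn n) (Γ : Conn n) (i k : Fin n) (D : Tensor n 2) :
    covT M Γ 0 sigVlS D ![i, k]
      = dt M (D ![i, k]) + ∑ r, D ![r, k] * Γ.G i r - D ![i, k] * Γ.κ
        - ∑ r, D ![i, r] * Γ.G r k := by
  simp [covT, sigVlS, update_pair_zero, update_pair_one, mul_sub, sum_sub_distrib,
    ← mul_assoc, ← sum_mul, sum_mul_kron']
  ring

lemma covT_sigVlV (M : Fin n → Fn n) (Γ : Conn n) (i k : Fin n) (D : Tensor n 2) :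
    covT M Γ 0 sigVlV D ![i, k]
      = dt M (D ![i, k]) + ∑ r, D ![r, k] * Γ.G i r - ∑ r, D ![i, r] * Γ.G r k := by
  simp [covT, sigVlV, update_pair_zero, update_pair_one, mul_sub, sum_sub_distrib,
    ← mul_assoc, ← sum_mul, sum_mul_kron', sum_mul_kron]
  ring

lemma covT_CT (M : Fin n → Fn n) (Γ : Conn n) (l i k : Fin n) :
    covT M Γ 0 sigC (CT Γ) ![l, i, k]
      = dt M (Γ.C l i k) + ∑ r, Γ.C r i k * Γ.G l r - ∑ r, Γ.G r i * Γ.C l r k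
        - ∑ r, Γ.C l i r * Γ.G r k + Γ.C l i k * Γ.κ := by
  simp [covT, sigC, CT, Fin.sum_univ_three, mul_sub, sum_sub_distrib, mul_comm (Γ.G _ i),
    ← mul_assoc, ← sum_mul, sum_mul_kron]
  ring

lemma covX_CT (N : Fin n → Fin n → Fn n) (Γ : Conn n) (j l i k : Fin n) :
    covX N Γ sigC j (CT Γ) ![l, i, k]
      = dx N j (Γ.C l i k) + ∑ r, Γ.C r i k * Γ.L l r j - ∑ r, Γ.L r i j * Γ.C l r k
        - ∑ r, Γ.C l i r * Γ.L r k j := by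
  simp [covX, sigC, CT, Fin.sum_univ_three, mul_comm (Γ.L _ i j)]
  ring

lemma sum_mul_yc_mul (f : Fn n) (A : Fin n → Fn n) :
    ∑ r, f * yc r * A r = f * ∑ r, yc r * A r := by
  simp only [mul_sum, mul_assoc]

lemma sum_yc_mul_mul (f : Fn n) (A : Fin n → Fn n) :
    ∑ r, yc r * (A r * f) = (∑ r, yc r * A r) * f := by
  simp only [sum_mul, mul_assoc]

/-- the five identities of the nonmetrical deflection d-tensors for an
`h`-normal Γ-linear connection of Cartan type. -/
theorem deflection_identities_cartan
    (n : ℕ) (hn : 1 ≤ n)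
    (h : ℝ → ℝ) (hh : ContDiff ℝ (⊤ : ℕ∞) h) (hhpos : ∀ t, 0 < h t)
    (M : Fin n → Fn n) (N : Fin n → Fin n → Fn n) (Γ : Conn n)
    (hκ : Γ.κ = chr h)
    (hMs : ∀ i, Smooth (M i)) (hNs : ∀ i j, Smooth (N i j))
    (hGs : ∀ k i, Smooth (Γ.G k i)) (hLs : ∀ k i j, Smooth (Γ.L k i j))
    (hCs : ∀ k i j, Smooth (Γ.C k i j))
    (hLsym : ∀ k i j, Γ.L k i j = Γ.L k j i) (hCsym : ∀ k i j, Γ.C k i j = Γ.C k j i) :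
    (∀ i k, covX N Γ sigV k (covT M Γ 0 sigV (famT yc)) ![i]
        - covT M Γ 0 sigVlS (fun a => covX N Γ sigV (a 1) (famT yc) ![a 0]) ![i, k]
      = (∑ r, yc r * Rc1 M N Γ i r k)
        - (∑ r, (covX N Γ sigV r (famT yc) ![i]) * T1 Γ r k)
        - (∑ r, (covY Γ sigV r (famT yc) ![i]) * Rv1 M N r k))
    ∧ (∀ i j k, covX N Γ sigVlS k (fun a => covX N Γ sigV (a 1) (famT yc) ![a 0]) ![i, j]
        - covX N Γ sigVlS j (fun a => covX N Γ sigV (a 1) (famT yc) ![a 0]) ![i, k]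
      = (∑ r, yc r * Rc M N Γ i r j k)
        - (∑ r, (covY Γ sigV r (famT yc) ![i]) * Rvsp M N r j k))
    ∧ (∀ i k, covY Γ sigV k (covT M Γ 0 sigV (famT yc)) ![i]
        - covT M Γ 0 sigVlV (fun a => covY Γ sigV (a 1) (famT yc) ![a 0]) ![i, k]
      = (∑ r, yc r * Pc1 M N Γ i r k)
        - (∑ r, (covY Γ sigV r (famT yc) ![i]) * Pv1 M Γ r k))
    ∧ (∀ i j k, covY Γ sigVlS k (fun a => covX N Γ sigV (a 1) (famT yc) ![a 0]) ![i, j]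
        - covX N Γ sigVlV j (fun a => covY Γ sigV (a 1) (famT yc) ![a 0]) ![i, k]
      = (∑ r, yc r * Pc M N Γ i r j k)
        - (∑ r, (covX N Γ sigV r (famT yc) ![i]) * Γ.C r j k)
        - (∑ r, (covY Γ sigV r (famT yc) ![i]) * Pvsp N Γ r j k))
    ∧ (∀ i j k, covY Γ sigVlV k (fun a => covY Γ sigV (a 1) (famT yc) ![a 0]) ![i, j]
        - covY Γ sigVlV j (fun a => covY Γ sigV (a 1) (famT yc) ![a 0]) ![i, k]
      = (∑ r, yc r * Sc Γ i r j k)) := by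
  have hκs : Smooth Γ.κ := hκ ▸ smooth_chr hh hhpos
  have hκx : ∀ k, dx N k Γ.κ = 0 := fun k => hκ ▸ dx_chr h N k
  have hκy : ∀ k, py k Γ.κ = 0 := fun k => hκ ▸ py_chr h k
  have hDbar : ∀ E, IsDerivation E → ∀ i,
      E ((-M i + -(Γ.κ * yc i)) + ∑ r, yc r * Γ.G i r)
        = -E (M i) - (E Γ.κ * yc i + Γ.κ * E (yc i))
          + ∑ r, E (yc r) * Γ.G i r + ∑ r, yc r * E (Γ.G i r) := by
    intro E hE i
    have hm := hκs.mul (smooth_yc i)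
    rw [hE.add_sum_yc_mul ((hMs i).neg.add hm.neg) fun r => hGs i r,
      hE.add _ _ (hMs i).neg hm.neg, hE.neg (hMs i), hE.neg hm, hE.mul _ _ hκs (smooth_yc i),
      ← sub_eq_add_neg]
  have hD : ∀ E, IsDerivation E → ∀ i j,
      E (-N i j + ∑ r, yc r * Γ.L i r j)
        = -E (N i j) + ∑ r, E (yc r) * Γ.L i r j + ∑ r, yc r * E (Γ.L i r j) := by
    intro E hE i j
    rw [hE.add_sum_yc_mul (hNs i j).neg fun r => hLs i r j, hE.neg (hNs i j)]
  have hd : ∀ E, IsDerivation E → ∀ i j,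
      E (kron i j + ∑ r, yc r * Γ.C i r j)
        = ∑ r, E (yc r) * Γ.C i r j + ∑ r, yc r * E (Γ.C i r j) := by
    intro E hE i j
    rw [hE.add_sum_yc_mul (smooth_kron i j) fun r => hCs i r j, hE.kron, zero_add]
  simp only [covT_yc, covX_yc, covY_yc]
  simp only [covX_sigV, covY_sigV, covX_sigVlS, covX_sigVlV,
    covY_sigVlS, covY_sigVlV, covT_sigVlS, covT_sigVlV, Rc1, Rc, Pc1, Pc, Sc, covT_CT, covX_CT,
    Matrix.cons_val_zero, Matrix.cons_val_one, T1,
    hDbar _ (isDerivation_dx N _), hDbar _ (isDerivation_py _), hD _ (isDerivation_dx N _),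
    hD _ (isDerivation_dt M), hD _ (isDerivation_py _), hd _ (isDerivation_dx N _),
    hd _ (isDerivation_dt M), hd _ (isDerivation_py _), dx_yc, dt_yc, py_yc, hκx, hκy,
    add_mul, neg_mul, mul_add, mul_sub, mul_neg, sum_add_distrib, sum_sub_distrib,
    sum_neg_distrib, sum_sum_yc_mul, sum_mul_yc_mul, sum_yc_mul_mul, sum_kron_mul, sum_kron_mul', zero_mul]
  refine ⟨fun i k => ?_, fun i j k => ?_, fun i k => ?_, fun i j k => ?_, fun i j k => ?_⟩
  · have hRv : Rv1 M N i k = dx N k (M i) - dt M (N i k) := rfl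
    linear_combination hRv
  · have hRv : Rvsp M N i j k = dx N k (N i j) - dx N j (N i k) := rfl
    simp only [hLsym _ k j]
    linear_combination hRv
  · have hPv : Pv1 M Γ i k = py k (M i) - Γ.G i k + kron i k * Γ.κ := rfl
    linear_combination hPv
  · have hPv : Pvsp N Γ i j k = py k (N i j) - Γ.L i k j := rfl
    linear_combination hPv
  · simp only [hCsym _ k j]
    ring

end Jet
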